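/- arXiv:2601.07950 — 2 statements merged into one kernel-verified Lean document; each statement's English description precedes it below -/
import Mathlib

section
/- Let m and M be positive integers. Then D(⟦-m,M⟧) = χ(⟦-m,M⟧). -/
def IsMinZeroSum (S : Multiset ℤ) : Prop :=
  S.sum = 0 ∧ ∀ T : Multiset ℤ, T ≤ S → T ≠ 0 → T ≠ S → T.sum ≠ 0

noncomputable def davenport (m M : ℕ) : ℕ :=
  sSup {n : ℕ | ∃ S : Multiset ℤ, IsMinZeroSum S ∧
    (∀ x ∈ S, -(m : ℤ) ≤ x ∧ x ≤ (M : ℤ)) ∧ S.card = n}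

noncomputable def chi (m M : ℕ) : ℤ :=
  sSup {z : ℤ | ∃ x y : ℤ, (-(m : ℤ) ≤ x ∧ x ≤ (M : ℤ)) ∧ (-(m : ℤ) ≤ y ∧ y ≤ (M : ℤ)) ∧
    x * y < 0 ∧ z = (|x| + |y|) / (Int.gcd x y : ℤ)}

section

open Finset

structure IsIndexedMinZeroSum (x y : ℕ → ℤ) (p q : ℕ) (A B : ℤ) : Prop where
  pos_left : ∀ i < p, 0 < x i
  le_left : ∀ i < p, x i ≤ A
  pos_right : ∀ j < q, 0 < y j
  le_right : ∀ j < q, y j ≤ B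
  sum_eq : ∑ i ∈ range p, x i = ∑ j ∈ range q, y j
  minimal : ∀ I ⊆ range p, ∀ J ⊆ range q, ∑ i ∈ I, x i = ∑ j ∈ J, y j →
    (I = ∅ ∧ J = ∅) ∨ (I = range p ∧ J = range q)

structure IsGreedyPath (x y : ℕ → ℤ) (u v : ℕ → ℕ) : Prop where
  left_zero : u 0 = 0
  right_zero : v 0 = 0
  step : ∀ t,
    (∑ i ∈ range (u t), x i ≤ ∑ j ∈ range (v t), y j ∧ u (t + 1) = u t + 1 ∧ v (t + 1) = v t) ∨
    (∑ j ∈ range (v t), y j < ∑ i ∈ range (u t), x i ∧ u (t + 1) = u t ∧ v (t + 1) = v t + 1)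

theorem exists_isGreedyPath (x y : ℕ → ℤ) : ∃ u v, IsGreedyPath x y u v := by
  let f : ℕ × ℕ → ℕ × ℕ := fun s =>
    if ∑ i ∈ range s.1, x i ≤ ∑ j ∈ range s.2, y j then (s.1 + 1, s.2) else (s.1, s.2 + 1)
  refine ⟨fun t => (f^[t] (0, 0)).1, fun t => (f^[t] (0, 0)).2, rfl, rfl, fun t => ?_⟩
  simp only [Function.iterate_succ_apply']
  set s := f^[t] (0, 0)
  by_cases h : ∑ i ∈ range s.1, x i ≤ ∑ j ∈ range s.2, y j
  · left; simp [f, h]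
  · right; simp [f, h, not_le.mp h]

namespace IsGreedyPath

variable {x y : ℕ → ℤ} {u v : ℕ → ℕ}

theorem add_eq (g : IsGreedyPath x y u v) (t : ℕ) : u t + v t = t := by
  induction t with
  | zero => simp [g.left_zero, g.right_zero]
  | succ t ih => rcases g.step t with h | h <;> omega

theorem monotone_left (g : IsGreedyPath x y u v) : Monotone u :=
  monotone_nat_of_le_succ fun t => by rcases g.step t with h | h <;> omega

theorem monotone_right (g : IsGreedyPath x y u v) : Monotone v :=
  monotone_nat_of_le_succ fun t => by rcases g.step t with h | h <;> omega

end IsGreedyPath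

namespace IsIndexedMinZeroSum

variable {x y : ℕ → ℤ} {p q : ℕ} {A B : ℤ} {u v : ℕ → ℕ}

theorem swap (h : IsIndexedMinZeroSum x y p q A B) : IsIndexedMinZeroSum y x q p B A :=
  ⟨h.pos_right, h.le_right, h.pos_left, h.le_left, h.sum_eq.symm, fun I hI J hJ hs => by
    rcases h.minimal J hJ I hI hs.symm with h | h
    · exact .inl h.symm
    · exact .inr h.symm⟩

theorem sum_left_mono (h : IsIndexedMinZeroSum x y p q A B) {i j : ℕ} (hij : i ≤ j)
    (hj : j ≤ p) : ∑ l ∈ range i, x l ≤ ∑ l ∈ range j, x l :=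
  sum_le_sum_of_subset_of_nonneg (range_mono hij) fun l hl _ =>
    (h.pos_left l (by simp at hl; omega)).le

theorem sum_left_lt (h : IsIndexedMinZeroSum x y p q A B) {i : ℕ} (hi : i < p) :
    ∑ l ∈ range i, x l < ∑ l ∈ range p, x l := by
  have := h.sum_left_mono (i := i + 1) hi le_rfl
  rw [sum_range_succ] at this
  linarith [h.pos_left i hi]

theorem sum_right_mono (h : IsIndexedMinZeroSum x y p q A B) {i j : ℕ} (hij : i ≤ j)
    (hj : j ≤ q) : ∑ l ∈ range i, y l ≤ ∑ l ∈ range j, y l := h.swap.sum_left_mono hij hj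

theorem sum_right_lt (h : IsIndexedMinZeroSum x y p q A B) {i : ℕ} (hi : i < q) :
    ∑ l ∈ range i, y l < ∑ l ∈ range q, y l := h.swap.sum_left_lt hi

/-- Along a chain of index sets, the partial sums of a minimal zero-sum sequence are distinct. -/
theorem sub_ne_sub (h : IsIndexedMinZeroSum x y p q A B) {I I' J J' : Finset ℕ}
    (hI : I ⊆ I') (hJ : J ⊆ J') (hI' : I' ⊆ range p) (hJ' : J' ⊆ range q)
    (hc : #I + #J < #I' + #J') (hc' : #I' + #J' < p + q) :
    ∑ i ∈ I, x i - ∑ j ∈ J, y j ≠ ∑ i ∈ I', x i - ∑ j ∈ J', y j := by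
  intro he
  have h1 := sum_sdiff (f := x) hI
  have h2 := sum_sdiff (f := y) hJ
  have c1 := card_sdiff_add_card_eq_card hI
  have c2 := card_sdiff_add_card_eq_card hJ
  rcases h.minimal (I' \ I) (sdiff_subset.trans hI') (J' \ J) (sdiff_subset.trans hJ')
    (by linarith) with ⟨e1, e2⟩ | ⟨e1, e2⟩
  · rw [e1] at c1; rw [e2] at c2
    simp at c1 c2; omega
  · rw [e1] at c1; rw [e2] at c2
    simp at c1 c2; omega

theorem path_le (h : IsIndexedMinZeroSum x y p q A B) (g : IsGreedyPath x y u v) {t : ℕ}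
    (ht : t ≤ p + q) : u t ≤ p ∧ v t ≤ q := by
  induction t with
  | zero => simp [g.left_zero, g.right_zero]
  | succ t ih =>
    obtain ⟨hu, hv⟩ := ih (by omega)
    have := g.add_eq t
    rcases g.step t with ⟨h1, h2, h3⟩ | ⟨h1, h2, h3⟩
    · refine ⟨?_, by omega⟩
      by_contra hc
      have e : u t = p := by omega
      have := h.sum_right_lt (i := v t) (by omega)
      rw [e, h.sum_eq] at h1
      linarith
    · refine ⟨by omega, ?_⟩
      by_contra hc
      have e : v t = q := by omega
      have := h.sum_left_lt (i := u t) (by omega)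
      rw [e, ← h.sum_eq] at h1
      linarith

theorem path_eq (h : IsIndexedMinZeroSum x y p q A B) (g : IsGreedyPath x y u v) :
    u (p + q) = p ∧ v (p + q) = q := by
  have := h.path_le g le_rfl
  have := g.add_eq (p + q)
  omega

theorem step_lt (h : IsIndexedMinZeroSum x y p q A B) (g : IsGreedyPath x y u v) {t : ℕ}
    (ht : t < p + q) :
    (∑ i ∈ range (u t), x i - ∑ j ∈ range (v t), y j ≤ 0 ∧ u t < p ∧
      u (t + 1) = u t + 1 ∧ v (t + 1) = v t) ∨
    (0 < ∑ i ∈ range (u t), x i - ∑ j ∈ range (v t), y j ∧ v t < q ∧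
      u (t + 1) = u t ∧ v (t + 1) = v t + 1) := by
  have := h.path_le g (t := t + 1) ht
  rcases g.step t with ⟨h1, h2, h3⟩ | ⟨h1, h2, h3⟩
  · left; exact ⟨by linarith, by omega, h2, h3⟩
  · right; exact ⟨by linarith, by omega, h2, h3⟩

theorem path_mem (h : IsIndexedMinZeroSum x y p q A B) (g : IsGreedyPath x y u v)
    (hA : 0 < A) (hB : 0 < B) {t : ℕ} (ht : t ≤ p + q) :
    ∑ i ∈ range (u t), x i - ∑ j ∈ range (v t), y j ∈ Ioc (-B) A := by
  induction t with
  | zero => simp [g.left_zero, g.right_zero]; omega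
  | succ t ih =>
    have := ih (by omega)
    rw [mem_Ioc] at this ⊢
    rcases h.step_lt g (t := t) ht with ⟨h1, h2, h3, h4⟩ | ⟨h1, h2, h3, h4⟩
    · rw [h3, h4, sum_range_succ]
      have := h.pos_left _ h2
      have := h.le_left _ h2
      constructor <;> linarith
    · rw [h3, h4, sum_range_succ]
      have := h.pos_right _ h2
      have := h.le_right _ h2
      constructor <;> linarith

theorem path_ne (h : IsIndexedMinZeroSum x y p q A B) (g : IsGreedyPath x y u v) {s t : ℕ}
    (hst : s < t) (ht : t < p + q) :
    ∑ i ∈ range (u s), x i - ∑ j ∈ range (v s), y j ≠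
      ∑ i ∈ range (u t), x i - ∑ j ∈ range (v t), y j := by
  have := h.path_le g ht.le
  refine h.sub_ne_sub (range_mono (g.monotone_left hst.le)) (range_mono (g.monotone_right hst.le))
    (range_mono this.1) (range_mono this.2) ?_ ?_
  · simpa [g.add_eq]
  · simpa [g.add_eq]

theorem path_injOn (h : IsIndexedMinZeroSum x y p q A B) (g : IsGreedyPath x y u v) :
    Set.InjOn (fun t => ∑ i ∈ range (u t), x i - ∑ j ∈ range (v t), y j) (range (p + q)) := by
  intro s hs t ht hst
  simp only [coe_range, Set.mem_Iio] at hs ht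
  rcases lt_trichotomy s t with hlt | rfl | hlt
  · exact (h.path_ne g hlt ht hst).elim
  · rfl
  · exact (h.path_ne g hlt hs hst.symm).elim

theorem exists_left_step (h : IsIndexedMinZeroSum x y p q A B) (g : IsGreedyPath x y u v) {i : ℕ}
    (hi : i < p) : ∃ t < p + q, u t = i ∧ u (t + 1) = i + 1 ∧ v (t + 1) = v t ∧
      ∑ i ∈ range (u t), x i - ∑ j ∈ range (v t), y j ≤ 0 := by
  classical
  have hex : ∃ t, i < u t := ⟨p + q, by rw [(h.path_eq g).1]; exact hi⟩
  have h1 := Nat.find_spec hex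
  have h2 : Nat.find hex ≤ p + q := Nat.find_min' hex (by rw [(h.path_eq g).1]; exact hi)
  obtain ⟨t, ht⟩ : ∃ t, Nat.find hex = t + 1 := Nat.exists_eq_succ_of_ne_zero fun h0 => by
    rw [h0, g.left_zero] at h1; omega
  have h3 := Nat.find_min hex (m := t) (by omega)
  rw [ht] at h1
  rcases h.step_lt g (t := t) (by omega) with ⟨a, b, c, d⟩ | ⟨a, b, c, d⟩
  · exact ⟨t, by omega, by omega, by omega, d, a⟩
  · omega

theorem exists_right_step (h : IsIndexedMinZeroSum x y p q A B) (g : IsGreedyPath x y u v) {j : ℕ}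
    (hj : j < q) : ∃ t < p + q, v t = j ∧ v (t + 1) = j + 1 ∧ u (t + 1) = u t ∧
      0 < ∑ i ∈ range (u t), x i - ∑ j ∈ range (v t), y j := by
  classical
  have hex : ∃ t, j < v t := ⟨p + q, by rw [(h.path_eq g).2]; exact hj⟩
  have h1 := Nat.find_spec hex
  have h2 : Nat.find hex ≤ p + q := Nat.find_min' hex (by rw [(h.path_eq g).2]; exact hj)
  obtain ⟨t, ht⟩ : ∃ t, Nat.find hex = t + 1 := Nat.exists_eq_succ_of_ne_zero fun h0 => by
    rw [h0, g.right_zero] at h1; omega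
  have h3 := Nat.find_min hex (m := t) (by omega)
  rw [ht] at h1
  rcases h.step_lt g (t := t) (by omega) with ⟨a, b, c, d⟩ | ⟨a, b, c, d⟩
  · omega
  · exact ⟨t, by omega, by omega, by omega, c, a⟩

theorem card_left_le (h : IsIndexedMinZeroSum x y p q A B) (hA : 0 < A) (hB : 0 < B) :
    (p : ℤ) ≤ B := by
  obtain ⟨u, v, g⟩ := exists_isGreedyPath x y
  choose! T hT hu _ _ hs using fun i (hi : i < p) => h.exists_left_step g hi
  have := card_le_card_of_injOn (s := range p) (t := Ioc (-B) 0)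
    (fun i => ∑ l ∈ range (u (T i)), x l - ∑ j ∈ range (v (T i)), y j)
    (fun i hi => by
      have hi : i < p := by simpa using hi
      have := h.path_mem g hA hB (hT i hi).le
      simp only [coe_Ioc, Set.mem_Ioc, mem_Ioc] at this ⊢
      exact ⟨this.1, hs i hi⟩)
    (fun i hi j hj hij => by
      have hi : i < p := by simpa using hi
      have hj : j < p := by simpa using hj
      have := h.path_injOn g (by simpa using hT i hi) (by simpa using hT j hj) hij
      rw [← hu i hi, ← hu j hj, this])
  simp at this
  omega

/-- If the sequence is ordered so that `2 * (k + l)` of its entries form ascending pairs, then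
swapping such a pair yields a partial sum that the greedy path misses. -/
theorem card_add_ascents_le (h : IsIndexedMinZeroSum x y p q A B) (hA : 0 < A) (hB : 0 < B)
    {k l : ℕ} (hk : 2 * k ≤ p) (hl : 2 * l ≤ q) (hx : ∀ i < k, x (2 * i) < x (2 * i + 1))
    (hy : ∀ j < l, y (2 * j) < y (2 * j + 1)) : ((p + q + k + l : ℕ) : ℤ) ≤ A + B := by
  obtain ⟨u, v, g⟩ := exists_isGreedyPath x y
  choose! T hT hu hu' hv' hs using fun i (hi : i < p) => h.exists_left_step g hi
  choose! W hW hw hw' hz' hr using fun j (hj : j < q) => h.exists_right_step g hj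
  let P : ℕ → ℤ := fun n => ∑ i ∈ range n, x i
  let N : ℕ → ℤ := fun n => ∑ j ∈ range n, y j
  let s : ℕ → ℤ := fun t => P (u t) - N (v t)
  let e : ℕ → ℤ := fun i => P (2 * i) + x (2 * i + 1) - N (v (T (2 * i)))
  let e' : ℕ → ℤ := fun j => P (u (W (2 * j))) - (N (2 * j) + y (2 * j + 1))
  let E : ℕ → Finset ℕ := fun i => insert (2 * i + 1) (range (2 * i))
  have hE : ∀ (f : ℕ → ℤ) i, ∑ a ∈ E i, f a = ∑ a ∈ range (2 * i), f a + f (2 * i + 1) := by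
    intro f i
    rw [sum_insert (by simp), add_comm]
  have cE : ∀ i, #(E i) = 2 * i + 1 := fun i => by
    rw [card_insert_of_notMem (by simp), card_range]
  have E1 : ∀ i n, n ≤ 2 * i → range n ⊆ E i := fun i n hn =>
    (range_mono hn).trans (subset_insert _ _)
  have E2 : ∀ i n, 2 * i + 2 ≤ n → E i ⊆ range n := fun i n hn a ha => by
    simp only [E, mem_insert, mem_range] at ha ⊢; omega
  have E3 : ∀ i j, i < j → E i ⊆ E j := fun i j hij =>
    (E2 i (2 * j) (by omega)).trans (E1 j _ le_rfl)
  have hul := fun t (ht : t < p + q) => h.path_le g (t := t) ht.le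
  have hadd := g.add_eq
  have mu := g.monotone_left
  have mv := g.monotone_right
  have es : ∀ i < k, ∀ t < p + q, e i ≠ s t := by
    intro i hi t ht
    have hTi := hT (2 * i) (by omega)
    have hui := hu (2 * i) (by omega)
    have hui' := hu' (2 * i) (by omega)
    have hvi' := hv' (2 * i) (by omega)
    have ha := hadd (T (2 * i))
    have hle := hul _ hTi
    have hle' := hul _ ht
    have ha' := hadd t
    rcases le_or_gt t (T (2 * i)) with hlt | hlt
    · have h1 := mu hlt
      have h2 := mv hlt
      have := h.sub_ne_sub (I := range (u t)) (J := range (v t)) (I' := E i)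
        (J' := range (v (T (2 * i)))) (E1 _ _ (by omega)) (range_mono h2) (E2 _ _ (by omega))
        (range_mono hle.2) (by simp [cE]; omega) (by simp [cE]; omega)
      rw [hE] at this
      exact this.symm
    · have h1 := mu (show T (2 * i) + 1 ≤ t from hlt)
      have h2 := mv hlt.le
      rcases (show u t = 2 * i + 1 ∨ 2 * i + 2 ≤ u t by omega) with h3 | h3
      · have h4 := h.sum_right_mono h2 hle'.2
        have h5 := hx i hi
        refine ne_of_gt ?_
        simp only [s, e, P, N, h3, sum_range_succ]
        linarith
      · have := h.sub_ne_sub (I := E i) (J := range (v (T (2 * i)))) (I' := range (u t))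
          (J' := range (v t)) (E2 _ _ h3) (range_mono h2) (range_mono hle'.1)
          (range_mono hle'.2) (by simp [cE]; omega) (by simp; omega)
        rwa [hE] at this
  have es' : ∀ j < l, ∀ t < p + q, e' j ≠ s t := by
    intro j hj t ht
    have hTi := hW (2 * j) (by omega)
    have hui := hw (2 * j) (by omega)
    have hui' := hw' (2 * j) (by omega)
    have hvi' := hz' (2 * j) (by omega)
    have ha := hadd (W (2 * j))
    have hle := hul _ hTi
    have hle' := hul _ ht
    have ha' := hadd t
    rcases le_or_gt t (W (2 * j)) with hlt | hlt
    · have h1 := mu hlt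
      have h2 := mv hlt
      have := h.sub_ne_sub (I := range (u t)) (J := range (v t)) (I' := range (u (W (2 * j))))
        (J' := E j) (range_mono h1) (E1 _ _ (by omega)) (range_mono hle.1) (E2 _ _ (by omega))
        (by simp [cE]; omega) (by simp [cE]; omega)
      rw [hE] at this
      exact this.symm
    · have h1 := mv (show W (2 * j) + 1 ≤ t from hlt)
      have h2 := mu hlt.le
      rcases (show v t = 2 * j + 1 ∨ 2 * j + 2 ≤ v t by omega) with h3 | h3
      · have h4 := h.sum_left_mono h2 hle'.1
        have h5 := hy j hj
        refine ne_of_lt ?_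
        simp only [s, e', P, N, h3, sum_range_succ]
        linarith
      · have := h.sub_ne_sub (I := range (u (W (2 * j)))) (J := E j) (I' := range (u t))
          (J' := range (v t)) (range_mono h2) (E2 _ _ h3) (range_mono hle'.1)
          (range_mono hle'.2) (by simp [cE]; omega) (by simp; omega)
        rwa [hE] at this
  have ee : ∀ i < k, ∀ j < k, i < j → e i ≠ e j := by
    intro i hi j hj hij
    have a1 := hadd (T (2 * i))
    have a2 := hadd (T (2 * j))
    have u1 := hu (2 * i) (by omega)
    have u2 := hu (2 * j) (by omega)
    have hle := hul _ (hT (2 * j) (by omega))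
    have h1 : T (2 * i) ≤ T (2 * j) := by
      by_contra hc
      have := mu (not_le.mp hc).le
      omega
    have := h.sub_ne_sub (I := E i) (J := range (v (T (2 * i)))) (I' := E j)
      (J' := range (v (T (2 * j)))) (E3 _ _ hij) (range_mono (mv h1)) (E2 _ _ (by omega))
      (range_mono hle.2) (by simp [cE]; have := mv h1; omega) (by simp [cE]; omega)
    rwa [hE, hE] at this
  have ee' : ∀ i < l, ∀ j < l, i < j → e' i ≠ e' j := by
    intro i hi j hj hij
    have a1 := hadd (W (2 * i))
    have a2 := hadd (W (2 * j))
    have u1 := hw (2 * i) (by omega)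
    have u2 := hw (2 * j) (by omega)
    have hle := hul _ (hW (2 * j) (by omega))
    have h1 : W (2 * i) ≤ W (2 * j) := by
      by_contra hc
      have := mv (not_le.mp hc).le
      omega
    have := h.sub_ne_sub (J := E i) (I := range (u (W (2 * i)))) (J' := E j)
      (I' := range (u (W (2 * j)))) (range_mono (mu h1)) (E3 _ _ hij) (range_mono hle.1)
      (E2 _ _ (by omega)) (by simp [cE]; have := mu h1; omega) (by simp [cE]; omega)
    rwa [hE, hE] at this
  have ef : ∀ i < k, ∀ j < l, e i ≠ e' j := by
    intro i hi j hj
    have a1 := hadd (T (2 * i))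
    have a2 := hadd (W (2 * j))
    have u1 := hu (2 * i) (by omega)
    have u1' := hu' (2 * i) (by omega)
    have u2 := hw (2 * j) (by omega)
    have u2' := hw' (2 * j) (by omega)
    have hle1 := hul _ (hT (2 * i) (by omega))
    have hle2 := hul _ (hW (2 * j) (by omega))
    have h5 := hx i hi
    have h6 := hy j hj
    have s1 := hs (2 * i) (by omega)
    have s2 := hr (2 * j) (by omega)
    rcases lt_trichotomy (T (2 * i)) (W (2 * j)) with hlt | heq | hlt
    · have h1 := mu (show T (2 * i) + 1 ≤ W (2 * j) from hlt)
      have h2 := mv hlt.le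
      rcases (show u (W (2 * j)) = 2 * i + 1 ∨ 2 * i + 2 ≤ u (W (2 * j)) by omega) with h3 | h3
      · have h4 := h.sum_right_mono h2 hle2.2
        rw [u2] at h4
        have h7 := h.pos_right (2 * j) (by omega)
        refine ne_of_gt ?_
        simp only [e, e', P, N, h3, sum_range_succ]
        linarith
      · have := h.sub_ne_sub (I := E i) (J := range (v (T (2 * i)))) (I' := range (u (W (2 * j))))
          (J' := E j) (E2 _ _ h3) (E1 _ _ (by omega)) (range_mono hle2.1) (E2 _ _ (by omega))
          (by simp [cE]; omega) (by simp [cE]; omega)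
        rwa [hE, hE] at this
    · rw [heq] at s1; omega
    · have h1 := mv (show W (2 * j) + 1 ≤ T (2 * i) from hlt)
      have h2 := mu hlt.le
      rcases (show v (T (2 * i)) = 2 * j + 1 ∨ 2 * j + 2 ≤ v (T (2 * i)) by omega) with h3 | h3
      · have h4 := h.sum_left_mono h2 hle1.1
        rw [u1] at h4
        have h7 := h.pos_left (2 * i) (by omega)
        refine ne_of_gt ?_
        simp only [e, e', P, N, h3, sum_range_succ]
        linarith
      · have := h.sub_ne_sub (I := range (u (W (2 * j)))) (J := E j) (I' := E i)
          (J' := range (v (T (2 * i)))) (E1 _ _ (by omega)) (E2 _ _ h3) (E2 _ _ (by omega))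
          (range_mono hle1.2) (by simp [cE]; omega) (by simp [cE]; omega)
        rw [hE, hE] at this
        exact this.symm
  let F : Fin (p + q) ⊕ Fin k ⊕ Fin l → ℤ :=
    Sum.elim (fun t => s t) (Sum.elim (fun i => e i) (fun j => e' j))
  have hF : Function.Injective F := by
    rintro (⟨a, ha⟩ | ⟨a, ha⟩ | ⟨a, ha⟩) (⟨b, hb⟩ | ⟨b, hb⟩ | ⟨b, hb⟩) hab <;>
      simp only [F, Sum.elim_inl, Sum.elim_inr] at hab
    · have := h.path_injOn g (by simpa using ha) (by simpa using hb) hab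
      simpa using this
    · exact (es b hb a ha hab.symm).elim
    · exact (es' b hb a ha hab.symm).elim
    · exact (es a ha b hb hab).elim
    · rcases lt_trichotomy a b with hlt | rfl | hlt
      · exact (ee _ ha _ hb hlt hab).elim
      · rfl
      · exact (ee _ hb _ ha hlt hab.symm).elim
    · exact (ef a ha b hb hab).elim
    · exact (es' a ha b hb hab).elim
    · exact (ef b hb a ha hab.symm).elim
    · rcases lt_trichotomy a b with hlt | rfl | hlt
      · exact (ee' _ ha _ hb hlt hab).elim
      · rfl
      · exact (ee' _ hb _ ha hlt hab.symm).elim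
  have hmem : ∀ a, F a ∈ Ioc (-B) A := by
    rintro (⟨a, ha⟩ | ⟨a, ha⟩ | ⟨a, ha⟩) <;> simp only [F, Sum.elim_inl, Sum.elim_inr]
    · exact h.path_mem g hA hB ha.le
    · have h1 := h.path_mem g hA hB (hT (2 * a) (by omega)).le
      have h2 := hs (2 * a) (by omega)
      have h3 := h.pos_left (2 * a + 1) (by omega)
      have h4 := h.le_left (2 * a + 1) (by omega)
      rw [hu (2 * a) (by omega), mem_Ioc] at h1
      rw [hu (2 * a) (by omega)] at h2
      simp only [mem_Ioc, e, P, N]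
      constructor <;> linarith
    · have h1 := h.path_mem g hA hB (hW (2 * a) (by omega)).le
      have h2 := hr (2 * a) (by omega)
      have h3 := h.pos_right (2 * a + 1) (by omega)
      have h4 := h.le_right (2 * a + 1) (by omega)
      rw [hw (2 * a) (by omega), mem_Ioc] at h1
      rw [hw (2 * a) (by omega)] at h2
      simp only [mem_Ioc, e', P, N]
      constructor <;> linarith
  have := card_le_card_of_injOn (s := univ) (t := Ioc (-B) A) F (fun a _ => hmem a) hF.injOn
  simp at this
  omega

end IsIndexedMinZeroSum

namespace IsIndexedMinZeroSum

variable {x y : ℕ → ℤ} {p q : ℕ} {A B : ℤ} {u v : ℕ → ℕ}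

theorem card_le_of_top_interval (h : IsIndexedMinZeroSum x y p q A B) (hA : 0 < A) (hB : 0 < B)
    {a b c : ℤ} (ha : 0 < a) (hac : a ≤ c) (hcA : A ≤ c + b) :
    ((p + q : ℕ) : ℤ) ≤ #{i ∈ range p | x i ≠ a} + #{j ∈ range q | y j ≠ b} + (B + c) := by
  obtain ⟨u, v, g⟩ := exists_isGreedyPath x y
  let s : ℕ → ℤ := fun t => ∑ i ∈ range (u t), x i - ∑ j ∈ range (v t), y j
  have hmem := fun t (ht : t < p + q) => h.path_mem g hA hB (t := t) ht.le
  have hinj : Set.InjOn s (range (p + q)) := h.path_injOn g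
  have hlow : #{t ∈ range (p + q) | s t ≤ c} ≤ #(Ioc (-B) c) := by
    refine card_le_card_of_injOn s (fun t ht => ?_) (hinj.mono (by simp; grind))
    simp only [coe_filter, Set.mem_ofPred_eq, mem_range] at ht
    have := hmem t ht.1
    simp only [coe_Ioc, Set.mem_Ioc, mem_Ioc] at this ⊢
    exact ⟨this.1, ht.2⟩
  have hhigh : #{t ∈ range (p + q) | ¬ s t ≤ c} ≤
      #{i ∈ range p | x i ≠ a} + #{j ∈ range q | y j ≠ b} := by
    rw [← card_filter_add_card_filter_not (fun t => u t = u (t - 1) + 1)]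
    have key : ∀ t < p + q, c < s t →
        (u t = u (t - 1) + 1 ∧ u (t - 1) < p ∧ x (u (t - 1)) ≠ a) ∨
        (u t = u (t - 1) ∧ v t = v (t - 1) + 1 ∧ v (t - 1) < q ∧ y (v (t - 1)) ≠ b) := by
      intro t ht hct
      obtain _ | t := t
      · simp [s, g.left_zero, g.right_zero] at hct; omega
      have h0 := hmem t (by omega)
      rw [mem_Ioc] at h0
      rcases h.step_lt g (t := t) (by omega) with ⟨h1, h2, h3, h4⟩ | ⟨h1, h2, h3, h4⟩
      · refine .inl ⟨h3, h2, fun he => ?_⟩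
        rw [Nat.add_sub_cancel] at he
        simp only [s, h3, h4, sum_range_succ] at hct
        linarith
      · refine .inr ⟨h3, h4, h2, fun he => ?_⟩
        rw [Nat.add_sub_cancel] at he
        simp only [s, h3, h4, sum_range_succ] at hct
        linarith
    refine add_le_add (card_le_card_of_injOn (fun t => u (t - 1)) (fun t ht => ?_) ?_)
      (card_le_card_of_injOn (fun t => v (t - 1)) (fun t ht => ?_) ?_)
    · simp only [coe_filter, mem_filter, mem_range, not_le, Set.mem_ofPred_eq] at ht ⊢
      rcases key t ht.1.1 ht.1.2 with h1 | h1
      · exact h1.2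
      · omega
    · intro t ht t' ht' he
      simp only [coe_filter, mem_filter, mem_range, not_le, Set.mem_ofPred_eq] at ht ht' he
      rcases lt_trichotomy t t' with hlt | heq | hlt
      · have := g.monotone_left (show t ≤ t' - 1 by omega)
        omega
      · exact heq
      · have := g.monotone_left (show t' ≤ t - 1 by omega)
        omega
    · simp only [coe_filter, mem_filter, mem_range, not_le, Set.mem_ofPred_eq] at ht ⊢
      rcases key t ht.1.1 ht.1.2 with h1 | h1
      · omega
      · exact h1.2.2
    · intro t ht t' ht' he
      simp only [coe_filter, mem_filter, mem_range, not_le, Set.mem_ofPred_eq] at ht ht' he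
      have k1 := key t ht.1.1 ht.1.2
      have k2 := key t' ht'.1.1 ht'.1.2
      rcases lt_trichotomy t t' with hlt | heq | hlt
      · have := g.monotone_right (show t ≤ t' - 1 by omega)
        omega
      · exact heq
      · have := g.monotone_right (show t' ≤ t - 1 by omega)
        omega
  have := card_filter_add_card_filter_not (s := range (p + q)) (fun t => s t ≤ c)
  simp only [card_range, Int.card_Ioc] at this hlow
  omega

theorem sum_Ico_sub_ne (h : IsIndexedMinZeroSum x y p q A B) (hA : 0 < A)
    {a b : ℤ} (ha : 0 < a) (hb : 0 < b) (hAab : A < a + b)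
    (hx : ∀ i, i + 1 < p → x i = a ∨ x (i + 1) = a) (hy0 : y 0 = b) (hyq : y (q - 1) = b)
    {i i' j j' : ℕ} (hi' : i' ≤ p) (hj' : j' ≤ q) :
    ∑ l ∈ Ico i i', x l - ∑ l ∈ Ico j j', y l ≠ a + b := by
  intro he
  have hI : Ico i i' ⊆ range p := fun l hl => by simp at hl ⊢; omega
  have hJ : Ico j j' ⊆ range q := fun l hl => by simp at hl ⊢; omega
  have hpos : 0 ≤ ∑ l ∈ Ico j j', y l := sum_nonneg fun l hl =>
    (h.pos_right l (by simpa using hJ hl)).le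
  by_cases h1 : ∃ l ∈ Ico i i', x l = a
  · obtain ⟨l, hl, hxl⟩ := h1
    by_cases h2 : ∃ m ∈ range q, m ∉ Ico j j' ∧ y m = b
    · obtain ⟨m, hm, hmJ, hym⟩ := h2
      have e1 := add_sum_erase _ x hl
      have e2 := sum_insert (f := y) hmJ
      rcases h.minimal ((Ico i i').erase l) ((erase_subset _ _).trans hI) (insert m (Ico j j'))
        (insert_subset hm hJ) (by linarith) with h3 | h3
      · simp at h3
      · have := hI hl
        rw [← h3.1] at this
        simp at this
    · push Not at h2
      have h5 : q ≠ 0 := by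
        rintro rfl
        have h4 := h.sum_eq
        simp only [range_zero, sum_empty] at h4
        have h6 := single_le_sum (f := x) (s := range p)
          (fun m hm => (h.pos_left m (by simpa using hm)).le) (hI hl)
        linarith
      have h3 : range q ⊆ Ico j j' := by
        have m0 : 0 ∈ Ico j j' := by
          by_contra hc
          exact h2 0 (by simp; omega) hc hy0
        have m1 : q - 1 ∈ Ico j j' := by
          by_contra hc
          exact h2 (q - 1) (by simp; omega) hc hyq
        intro m hm
        simp at m0 m1 hm ⊢
        omega
      have h4 := subset_antisymm h3 hJ
      rw [← h4, ← h.sum_eq] at he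
      have := sum_le_sum_of_subset_of_nonneg (f := x) hI
        (fun m hm _ => (h.pos_left m (by simpa using hm)).le)
      linarith
  · push Not at h1
    have h2 : i' ≤ i + 1 := by
      by_contra hc
      rcases hx i (by omega) with h3 | h3
      · exact h1 i (by simp; omega) h3
      · exact h1 (i + 1) (by simp; omega) h3
    have h3 : ∑ l ∈ Ico i i', x l ≤ A := by
      rcases (show i' ≤ i ∨ i' = i + 1 by omega) with h3 | h3
      · simp [Ico_eq_empty_of_le h3, hA.le]
      · rw [h3]
        simpa using h.le_left i (by omega)
    linarith

theorem card_le_add (h : IsIndexedMinZeroSum x y p q A B) (hA : 0 < A) (hB : 0 < B)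
    {a b : ℤ} (ha : 0 < a) (hb : 0 < b) (hAab : A < a + b) (hBab : B < a + b)
    (hx : ∀ i, i + 1 < p → x i = a ∨ x (i + 1) = a) (hx0 : x 0 = a) (hxp : x (p - 1) = a)
    (hy : ∀ i, i + 1 < q → y i = b ∨ y (i + 1) = b) (hy0 : y 0 = b) (hyq : y (q - 1) = b) :
    ((p + q : ℕ) : ℤ) ≤ a + b := by
  obtain ⟨u, v, g⟩ := exists_isGreedyPath x y
  let s : ℕ → ℤ := fun t => ∑ i ∈ range (u t), x i - ∑ j ∈ range (v t), y j
  have key : ∀ t t', t < t' → t' < p + q → s t % (a + b) ≠ s t' % (a + b) := by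
    intro t t' hlt ht' he
    obtain ⟨c, hc⟩ := (Int.ModEq.dvd he : a + b ∣ s t' - s t)
    have m1 := h.path_mem g hA hB (t := t) (by omega)
    have m2 := h.path_mem g hA hB (t := t') (by omega)
    rw [mem_Ioc] at m1 m2
    have hle := h.path_le g (t := t') (by omega)
    have d1 : s t' - s t < A + B := by simp only [s]; linarith
    have d2 : -(A + B) < s t' - s t := by simp only [s]; linarith
    have i1 := sum_Ico_eq_sub x (g.monotone_left hlt.le)
    have i2 := sum_Ico_eq_sub y (g.monotone_right hlt.le)
    have c1 : c < 2 := by by_contra hcc; nlinarith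
    have c2 : -2 < c := by by_contra hcc; nlinarith
    have hne := h.path_ne g hlt ht'
    rcases (show c = -1 ∨ c = 0 ∨ c = 1 by omega) with rfl | rfl | rfl
    · refine h.swap.sum_Ico_sub_ne hB hb ha (by linarith) hy hx0 hxp hle.2 hle.1
        (i := v t) (j := u t) ?_
      rw [i1, i2]
      simp only [s] at hc
      linarith
    · apply hne
      simp only [s] at hc
      linarith
    · refine h.sum_Ico_sub_ne hA ha hb hAab hx hy0 hyq hle.1 hle.2
        (i := u t) (j := v t) ?_
      rw [i1, i2]
      simp only [s] at hc
      linarith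
  have := card_le_card_of_injOn (s := range (p + q)) (t := Ico 0 (a + b)) (fun t => s t % (a + b))
    (fun t _ => by
      simp only [coe_Ico, Set.mem_Ico]
      exact ⟨Int.emod_nonneg _ (by omega), Int.emod_lt_of_pos _ (by omega)⟩)
    (fun t ht t' ht' he => by
      simp only [coe_range, Set.mem_Iio] at ht ht'
      rcases lt_trichotomy t t' with hlt | heq | hlt
      · exact (key t t' hlt ht' he).elim
      · exact heq
      · exact (key t' t hlt ht he.symm).elim)
  simp at this
  omega

end IsIndexedMinZeroSum

theorem exists_coprime_six_near (A : ℕ) (hA : 0 < A) :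
    ∃ y, 1 ≤ y ∧ y ≤ A ∧ A ≤ y + 3 ∧ y.Coprime 6 := by
  by_cases h : A ≤ 3
  · exact ⟨1, by omega, by omega, by omega, by decide⟩
  have key : ∀ z, z % 6 = 1 ∨ z % 6 = 5 → z.Coprime 6 := fun z hz => by
    rw [Nat.Coprime, Nat.gcd_comm, Nat.gcd_rec]
    rcases hz with hz | hz <;> rw [hz] <;> decide
  rcases (show A % 6 = 1 ∨ A % 6 = 5 ∨ A % 6 = 0 ∨ A % 6 = 2 ∨ A % 6 = 3 ∨ A % 6 = 4 by omega)
    with h1 | h1 | h1 | h1 | h1 | h1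
  · exact ⟨A, by omega, by omega, by omega, key _ (by omega)⟩
  · exact ⟨A, by omega, by omega, by omega, key _ (by omega)⟩
  · exact ⟨A - 1, by omega, by omega, by omega, key _ (by omega)⟩
  · exact ⟨A - 1, by omega, by omega, by omega, key _ (by omega)⟩
  · exact ⟨A - 2, by omega, by omega, by omega, key _ (by omega)⟩
  · exact ⟨A - 3, by omega, by omega, by omega, key _ (by omega)⟩

theorem exists_three_smooth_near (B : ℕ) (hB : 64 ≤ B) :
    ∃ x, 1 ≤ x ∧ x ≤ B ∧ 4 * (B - x) + 14 ≤ x ∧ ∀ y : ℕ, y.Coprime 6 → y.Coprime x := by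
  obtain ⟨s, hs1, hs2⟩ : ∃ s, 2 ^ s * 64 ≤ B ∧ B < 2 ^ (s + 1) * 64 := by
    have h0 : B / 64 ≠ 0 := by omega
    have h1 := Nat.pow_log_le_self 2 h0
    have h2 := Nat.lt_pow_succ_log_self (b := 2) (by norm_num) (B / 64)
    exact ⟨Nat.log 2 (B / 64), by omega, by omega⟩
  have hcop : ∀ a b y : ℕ, y.Coprime 6 → y.Coprime (2 ^ a * 3 ^ b) := fun a b y hy =>
    Nat.Coprime.mul_right (Nat.Coprime.pow_right _ (hy.coprime_dvd_right (by norm_num)))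
      (Nat.Coprime.pow_right _ (hy.coprime_dvd_right (by norm_num)))
  have hpos : 0 < 2 ^ s := by positivity
  rw [pow_succ] at hs2
  have e1 : 2 ^ s * 64 = 2 ^ (s + 6) * 3 ^ 0 := by ring
  have e2 : 2 ^ s * 72 = 2 ^ (s + 3) * 3 ^ 2 := by ring
  have e3 : 2 ^ s * 81 = 2 ^ s * 3 ^ 4 := by ring
  have e4 : 2 ^ s * 96 = 2 ^ (s + 5) * 3 ^ 1 := by ring
  have e5 : 2 ^ s * 108 = 2 ^ (s + 2) * 3 ^ 3 := by ring
  rcases lt_or_ge B (2 ^ s * 72) with h | h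
  · exact ⟨2 ^ s * 64, by omega, by omega, by omega, by rw [e1]; exact hcop _ _⟩
  rcases lt_or_ge B (2 ^ s * 81) with h | h
  · exact ⟨2 ^ s * 72, by omega, by omega, by omega, by rw [e2]; exact hcop _ _⟩
  rcases lt_or_ge B (2 ^ s * 96) with h | h
  · exact ⟨2 ^ s * 81, by omega, by omega, by omega, by rw [e3]; exact hcop _ _⟩
  rcases lt_or_ge B (2 ^ s * 108) with h | h
  · exact ⟨2 ^ s * 96, by omega, by omega, by omega, by rw [e4]; exact hcop _ _⟩
  · exact ⟨2 ^ s * 108, by omega, by omega, by omega, by rw [e5]; exact hcop _ _⟩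

theorem exists_prime_pow_near {B : ℕ} (hB : 0 < B) (hB' : B < 64) :
    ∃ p e : ℕ, (p = 1 ∨ p.Prime) ∧ p ^ e ≤ B ∧ B ≤ p ^ e + B / 5 := by
  rcases lt_or_ge B 2 with h1 | h1
  · exact ⟨1, 1, by norm_num, by omega, by omega⟩
  rcases lt_or_ge B 3 with h1 | h1
  · exact ⟨2, 1, by norm_num, by omega, by omega⟩
  rcases lt_or_ge B 4 with h1 | h1
  · exact ⟨3, 1, by norm_num, by omega, by omega⟩
  rcases lt_or_ge B 5 with h1 | h1
  · exact ⟨2, 2, by norm_num, by omega, by omega⟩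
  rcases lt_or_ge B 7 with h1 | h1
  · exact ⟨5, 1, by norm_num, by omega, by omega⟩
  rcases lt_or_ge B 9 with h1 | h1
  · exact ⟨7, 1, by norm_num, by omega, by omega⟩
  rcases lt_or_ge B 12 with h1 | h1
  · exact ⟨3, 2, by norm_num, by omega, by omega⟩
  rcases lt_or_ge B 14 with h1 | h1
  · exact ⟨11, 1, by norm_num, by omega, by omega⟩
  rcases lt_or_ge B 17 with h1 | h1
  · exact ⟨13, 1, by norm_num, by omega, by omega⟩
  rcases lt_or_ge B 22 with h1 | h1
  · exact ⟨17, 1, by norm_num, by omega, by omega⟩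
  rcases lt_or_ge B 24 with h1 | h1
  · exact ⟨19, 1, by norm_num, by omega, by omega⟩
  rcases lt_or_ge B 29 with h1 | h1
  · exact ⟨23, 1, by norm_num, by omega, by omega⟩
  rcases lt_or_ge B 37 with h1 | h1
  · exact ⟨29, 1, by norm_num, by omega, by omega⟩
  rcases lt_or_ge B 47 with h1 | h1
  · exact ⟨37, 1, by norm_num, by omega, by omega⟩
  rcases lt_or_ge B 59 with h1 | h1
  · exact ⟨47, 1, by norm_num, by omega, by omega⟩
  exact ⟨59, 1, by norm_num, by omega, by omega⟩

theorem exists_coprime_pair_of_le {A B k : ℕ} (hB : 0 < B) (hBA : B ≤ A) (hk : B < 5 * k) :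
    ∃ x y, 1 ≤ x ∧ x ≤ B ∧ 1 ≤ y ∧ y ≤ A ∧ x.Coprime y ∧ A + B ≤ x + y + k := by
  rcases lt_or_ge B 64 with h | h
  · obtain ⟨p, e, hp, hle, hle'⟩ := exists_prime_pow_near hB h
    rcases hp with rfl | hp
    · exact ⟨1, A, by omega, by omega, by omega, by omega, by simp, by simp at hle'; omega⟩
    · have hpe : 1 ≤ p ^ e := Nat.one_le_pow _ _ hp.pos
      by_cases hd : p ∣ A
      · have h2 : ¬ p ∣ A - 1 := fun h3 => by
          have := Nat.dvd_sub hd h3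
          rw [show A - (A - 1) = 1 by omega] at this
          exact hp.one_lt.ne' (Nat.dvd_one.mp this)
        have h3 := Nat.le_of_dvd (by omega) hd
        have := hp.two_le
        exact ⟨p ^ e, A - 1, hpe, hle, by omega, by omega,
          Nat.Coprime.pow_left _ ((Nat.Prime.coprime_iff_not_dvd hp).mpr h2), by omega⟩
      · exact ⟨p ^ e, A, hpe, hle, by omega, by omega,
          Nat.Coprime.pow_left _ ((Nat.Prime.coprime_iff_not_dvd hp).mpr hd), by omega⟩
  · obtain ⟨x, hx1, hx2, hx3, hx4⟩ := exists_three_smooth_near B h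
    obtain ⟨y, hy1, hy2, hy3, hy4⟩ := exists_coprime_six_near A (by omega)
    exact ⟨x, y, hx1, hx2, hy1, hy2, (hx4 y hy4).symm, by omega⟩

theorem exists_coprime_pair {A B k : ℕ} (hA : 0 < A) (hB : 0 < B) (hk : A < 5 * k ∨ B < 5 * k) :
    ∃ x y, 1 ≤ x ∧ x ≤ B ∧ 1 ≤ y ∧ y ≤ A ∧ x.Coprime y ∧ A + B ≤ x + y + k := by
  rcases le_total B A with h | h
  · exact exists_coprime_pair_of_le hB h (by omega)
  · obtain ⟨x, y, h1, h2, h3, h4, h5, h6⟩ := exists_coprime_pair_of_le (k := k) hA h (by omega)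
    exact ⟨y, x, h3, h4, h1, h2, h5.symm, by omega⟩

structure IsMinZeroSumPair (X Y : Multiset ℤ) : Prop where
  sum_eq : X.sum = Y.sum
  minimal : ∀ T ≤ X, ∀ U ≤ Y, T.sum = U.sum → (T = 0 ∧ U = 0) ∨ (T = X ∧ U = Y)

/-- The multiset consisting of the entries of the pairs in `Q` and of `n` copies of `a`. -/
def pairedMultiset (Q : List (ℤ × ℤ)) (n : ℕ) (a : ℤ) : Multiset ℤ :=
  ↑(Q.map Prod.fst) + ↑(Q.map Prod.snd) + Multiset.replicate n a

theorem card_pairedMultiset (Q : List (ℤ × ℤ)) (n : ℕ) (a : ℤ) :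
    (pairedMultiset Q n a).card = 2 * Q.length + n := by
  simp [pairedMultiset]; omega

theorem map_range_getD {α : Type*} (l : List α) (d : α) :
    (Multiset.range l.length).map (fun i => l.getD i d) = ↑l := by
  rw [← Multiset.coe_range, Multiset.map_coe]
  congr 1
  apply List.ext_getElem
  · simp
  · intro i h1 h2
    simp [h2]

theorem map_range_two_mul {α : Type*} (x : ℕ → α) (h : ℕ) :
    (Multiset.range (2 * h)).map x =
      (Multiset.range h).map (fun i => x (2 * i)) +
        (Multiset.range h).map (fun i => x (2 * i + 1)) := by
  induction h with
  | zero => simp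
  | succ h ih =>
    rw [show 2 * (h + 1) = 2 * h + 1 + 1 by ring, Multiset.range_succ, Multiset.range_succ,
      Multiset.range_succ, Multiset.map_cons, Multiset.map_cons, ih, Multiset.map_cons,
      Multiset.map_cons, Multiset.cons_add, Multiset.add_cons, Multiset.cons_swap]

/-- An enumeration of `pairedMultiset Q n a` that keeps the pairs adjacent. -/
def pairedSeq (Q : List (ℤ × ℤ)) (a : ℤ) (i : ℕ) : ℤ :=
  if i % 2 = 0 then (Q.getD (i / 2) (a, a)).1 else (Q.getD (i / 2) (a, a)).2

theorem pairedSeq_even (Q : List (ℤ × ℤ)) (a : ℤ) (i : ℕ) :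
    pairedSeq Q a (2 * i) = (Q.getD i (a, a)).1 := by
  simp [pairedSeq]

theorem pairedSeq_odd (Q : List (ℤ × ℤ)) (a : ℤ) (i : ℕ) :
    pairedSeq Q a (2 * i + 1) = (Q.getD i (a, a)).2 := by
  simp only [pairedSeq, show (2 * i + 1) % 2 = 1 by omega, show (2 * i + 1) / 2 = i by omega]
  simp

theorem pairedSeq_of_le (Q : List (ℤ × ℤ)) (a : ℤ) {i : ℕ} (hi : 2 * Q.length ≤ i) :
    pairedSeq Q a i = a := by
  have : Q.length ≤ i / 2 := by omega
  simp [pairedSeq, this]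

theorem map_pairedSeq (Q : List (ℤ × ℤ)) (n : ℕ) (a : ℤ) :
    (Multiset.range (2 * Q.length + n)).map (pairedSeq Q a) = pairedMultiset Q n a := by
  rw [Multiset.range_add, Multiset.map_add, map_range_two_mul, pairedMultiset]
  congr 1
  · congr 1
    · simp only [pairedSeq_even]
      have := congrArg (Multiset.map Prod.fst) (map_range_getD Q (a, a))
      rwa [Multiset.map_map, Multiset.map_coe] at this
    · simp only [pairedSeq_odd]
      have := congrArg (Multiset.map Prod.snd) (map_range_getD Q (a, a))
      rwa [Multiset.map_map, Multiset.map_coe] at this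
  · rw [Multiset.map_map, Multiset.eq_replicate]
    refine ⟨by simp, fun b hb => ?_⟩
    obtain ⟨i, -, rfl⟩ := Multiset.mem_map.mp hb
    exact pairedSeq_of_le Q a (Nat.le_add_right _ _)

theorem exists_eq_pairedMultiset (X : Multiset ℤ) :
    ∃ Q n a, X = pairedMultiset Q n a ∧ ∀ z ∈ Q, z.1 < z.2 := by
  induction hc : X.card using Nat.strong_induction_on generalizing X with
  | _ N ih =>
    by_cases h : ∃ a, ∀ b ∈ X, b = a
    · obtain ⟨a, ha⟩ := h
      exact ⟨[], X.card, a, by simpa [pairedMultiset] using Multiset.eq_replicate_card.mpr ha,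
        by simp⟩
    · push Not at h
      obtain ⟨c, hcX, -⟩ := h 0
      obtain ⟨d, hdX, hdc⟩ := h c
      obtain ⟨Z, rfl⟩ := Multiset.exists_cons_of_mem hcX
      obtain ⟨W, rfl⟩ := Multiset.exists_cons_of_mem
        ((Multiset.mem_cons.mp hdX).resolve_left hdc)
      simp only [Multiset.card_cons] at hc
      obtain ⟨Q, n, a, hW, hQ⟩ := ih W.card (by omega) W rfl
      have aux : ∀ e f, e ::ₘ f ::ₘ W = pairedMultiset ((e, f) :: Q) n a := fun e f => by
        rw [hW]
        simp only [pairedMultiset, List.map_cons, ← Multiset.cons_coe, Multiset.cons_add,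
          Multiset.add_cons]
        rw [Multiset.cons_swap]
      rcases lt_or_gt_of_ne hdc with hlt | hlt
      · exact ⟨(d, c) :: Q, n, a, by rw [← aux, Multiset.cons_swap], by simp; grind⟩
      · exact ⟨(c, d) :: Q, n, a, by rw [← aux], by simp; grind⟩

theorem filter_ne_add_replicate (X : Multiset ℤ) (a : ℤ) :
    X.filter (· ≠ a) + Multiset.replicate (X.count a) a = X := by
  rw [← Multiset.filter_eq', add_comm, Multiset.filter_add_not]

theorem card_filter_ne_add_count (X : Multiset ℤ) (a : ℤ) :
    (X.filter (· ≠ a)).card + X.count a = X.card := by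
  simpa using congrArg Multiset.card (filter_ne_add_replicate X a)

theorem eq_pairedMultiset_of_list (X : Multiset ℤ) (a : ℤ) (f : ℤ → ℤ × ℤ)
    (hf : ∀ r, (f r = (a, r) ∨ f r = (r, a)))
    (h : (X.filter (· ≠ a)).card ≤ X.count a) :
    X = pairedMultiset ((X.filter (· ≠ a)).toList.map f)
      (X.count a - (X.filter (· ≠ a)).card) a := by
  have key : ∀ l : List ℤ, (↑((l.map f).map Prod.fst) + ↑((l.map f).map Prod.snd) : Multiset ℤ) =
      ↑l + Multiset.replicate l.length a := by
    intro l
    induction l with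
    | nil => simp
    | cons r l ih =>
      simp only [List.map_cons, ← Multiset.cons_coe, List.length_cons, Multiset.replicate_succ,
        Multiset.cons_add, Multiset.add_cons, ih]
      rcases hf r with hr | hr <;> rw [hr]
      rw [Multiset.cons_swap]
  rw [pairedMultiset, key, Multiset.coe_toList, add_assoc, Multiset.length_toList,
    ← Multiset.replicate_add, Nat.add_sub_cancel' h, filter_ne_add_replicate]

namespace IsMinZeroSumPair

variable {X Y : Multiset ℤ} {A B : ℤ}

theorem swap (h : IsMinZeroSumPair X Y) : IsMinZeroSumPair Y X :=
  ⟨h.sum_eq.symm, fun T hT U hU hs => by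
    rcases h.minimal U hU T hT hs.symm with h | h
    · exact .inl h.symm
    · exact .inr h.symm⟩

theorem toIndexed (h : IsMinZeroSumPair X Y) (hX : ∀ x ∈ X, 0 < x ∧ x ≤ A)
    (hY : ∀ y ∈ Y, 0 < y ∧ y ≤ B) {x y : ℕ → ℤ} {p q : ℕ}
    (hx : (Multiset.range p).map x = X) (hy : (Multiset.range q).map y = Y) :
    IsIndexedMinZeroSum x y p q A B := by
  have mx : ∀ i < p, x i ∈ X := fun i hi => hx ▸ Multiset.mem_map_of_mem x (by simpa using hi)
  have my : ∀ i < q, y i ∈ Y := fun i hi => hy ▸ Multiset.mem_map_of_mem y (by simpa using hi)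
  have aux : ∀ (f : ℕ → ℤ) (n : ℕ) (I : Finset ℕ), I ⊆ range n →
      I.val.map f = (Multiset.range n).map f → I = range n := fun f n I hI he => by
    refine eq_of_subset_of_card_le hI ?_
    have := congrArg Multiset.card he
    simp at this
    simp [this]
  refine ⟨fun i hi => (hX _ (mx i hi)).1, fun i hi => (hX _ (mx i hi)).2,
    fun i hi => (hY _ (my i hi)).1, fun i hi => (hY _ (my i hi)).2, ?_, ?_⟩
  · have := h.sum_eq
    rwa [← hx, ← hy] at this
  · intro I hI J hJ hs
    rcases h.minimal (I.val.map x) (hx ▸ Multiset.map_le_map (val_le_iff.mpr hI))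
      (J.val.map y) (hy ▸ Multiset.map_le_map (val_le_iff.mpr hJ)) hs with ⟨h1, h2⟩ | ⟨h1, h2⟩
    · left
      simpa using And.intro h1 h2
    · right
      exact ⟨aux x p I hI (h1.trans hx.symm), aux y q J hJ (h2.trans hy.symm)⟩

theorem card_left_le (h : IsMinZeroSumPair X Y) (hX : ∀ x ∈ X, 0 < x ∧ x ≤ A)
    (hY : ∀ y ∈ Y, 0 < y ∧ y ≤ B) (hA : 0 < A) (hB : 0 < B) : (X.card : ℤ) ≤ B := by
  have hx := map_range_getD X.toList 0
  have hy := map_range_getD Y.toList 0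
  rw [Multiset.coe_toList] at hx hy
  simpa using (h.toIndexed hX hY hx hy).card_left_le hA hB

theorem card_add_length_le (h : IsMinZeroSumPair X Y) (hX : ∀ x ∈ X, 0 < x ∧ x ≤ A)
    (hY : ∀ y ∈ Y, 0 < y ∧ y ≤ B) (hA : 0 < A) (hB : 0 < B) {Q Q' : List (ℤ × ℤ)} {n n' : ℕ}
    {a b : ℤ} (hQX : X = pairedMultiset Q n a) (hQY : Y = pairedMultiset Q' n' b)
    (hQ : ∀ z ∈ Q, z.1 < z.2) (hQ' : ∀ z ∈ Q', z.1 < z.2) :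
    ((X.card + Y.card + Q.length + Q'.length : ℕ) : ℤ) ≤ A + B := by
  have hi := h.toIndexed hX hY ((map_pairedSeq Q n a).trans hQX.symm)
    ((map_pairedSeq Q' n' b).trans hQY.symm)
  rw [hQX, hQY, card_pairedMultiset, card_pairedMultiset]
  refine hi.card_add_ascents_le hA hB (by omega) (by omega) (fun i hi => ?_) (fun i hi => ?_)
  · rw [pairedSeq_even, pairedSeq_odd, List.getD_eq_getElem _ _ hi]
    exact hQ _ (List.getElem_mem hi)
  · rw [pairedSeq_even, pairedSeq_odd, List.getD_eq_getElem _ _ hi]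
    exact hQ' _ (List.getElem_mem hi)

theorem card_add_card_filter_ne_le (h : IsMinZeroSumPair X Y) (hX : ∀ x ∈ X, 0 < x ∧ x ≤ A)
    (hY : ∀ y ∈ Y, 0 < y ∧ y ≤ B) (hA : 0 < A) (hB : 0 < B) {a b : ℤ}
    (ha : (X.filter (· ≠ a)).card ≤ X.count a) (hb : (Y.filter (· ≠ b)).card ≤ Y.count b) :
    ((X.card + Y.card + (X.filter (· ≠ a)).card + (Y.filter (· ≠ b)).card : ℕ) : ℤ) ≤ A + B := by
  have key : ∀ (Z : Multiset ℤ) (c : ℤ),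
      ∀ z ∈ (Z.filter (· ≠ c)).toList.map (fun r => (min c r, max c r)), z.1 < z.2 := by
    intro Z c z hz
    simp only [List.mem_map, Multiset.mem_toList, Multiset.mem_filter] at hz
    obtain ⟨r, ⟨-, hr⟩, rfl⟩ := hz
    exact min_lt_max.mpr hr.symm
  have hf : ∀ c r : ℤ, (min c r, max c r) = (c, r) ∨ (min c r, max c r) = (r, c) := by
    intro c r
    rcases le_total c r with h | h <;> simp [h]
  simpa using h.card_add_length_le hX hY hA hB (eq_pairedMultiset_of_list X a _ (hf a) ha)
    (eq_pairedMultiset_of_list Y b _ (hf b) hb) (key X a) (key Y b)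

theorem card_le_of_top_interval (h : IsMinZeroSumPair X Y) (hX : ∀ x ∈ X, 0 < x ∧ x ≤ A)
    (hY : ∀ y ∈ Y, 0 < y ∧ y ≤ B) (hA : 0 < A) (hB : 0 < B)
    {a b c : ℤ} (ha : 0 < a) (hac : a ≤ c) (hcA : A ≤ c + b) :
    ((X.card + Y.card : ℕ) : ℤ) ≤
      (X.filter (· ≠ a)).card + (Y.filter (· ≠ b)).card + (B + c) := by
  have hx := map_range_getD X.toList 0
  have hy := map_range_getD Y.toList 0
  rw [Multiset.coe_toList] at hx hy
  have key : ∀ (x : ℕ → ℤ) (n : ℕ) (Z : Multiset ℤ) (c : ℤ), (Multiset.range n).map x = Z →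
      #{i ∈ range n | x i ≠ c} = (Z.filter (· ≠ c)).card := by
    intro x n Z c hZ
    rw [← hZ, Multiset.filter_map, Multiset.card_map]
    rfl
  have := (h.toIndexed hX hY hx hy).card_le_of_top_interval hA hB ha hac hcA
  rw [key _ _ _ _ hx, key _ _ _ _ hy] at this
  simpa using this

theorem card_le_add (h : IsMinZeroSumPair X Y) (hX : ∀ x ∈ X, 0 < x ∧ x ≤ A)
    (hY : ∀ y ∈ Y, 0 < y ∧ y ≤ B) (hA : 0 < A) (hB : 0 < B)
    {a b : ℤ} (ha : 0 < a) (hb : 0 < b) (hAab : A < a + b) (hBab : B < a + b)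
    (hXa : (X.filter (· ≠ a)).card < X.count a) (hYb : (Y.filter (· ≠ b)).card < Y.count b) :
    ((X.card + Y.card : ℕ) : ℤ) ≤ a + b := by
  have even : ∀ (l : List ℤ) (c : ℤ) (i : ℕ),
      pairedSeq (l.map fun r => (c, r)) c (2 * i) = c := by
    intro l c i
    rw [pairedSeq_even]
    rcases lt_or_ge i l.length with hi | hi
    · rw [List.getD_eq_getElem _ _ (by simpa using hi)]
      simp
    · rw [List.getD_eq_default _ _ (by simpa using hi)]
  have adj : ∀ (l : List ℤ) (c : ℤ) (i : ℕ), pairedSeq (l.map fun r => (c, r)) c i = c ∨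
      pairedSeq (l.map fun r => (c, r)) c (i + 1) = c := by
    intro l c i
    rcases Nat.even_or_odd' i with ⟨j, rfl | rfl⟩
    · exact .inl (even l c j)
    · exact .inr (even l c (j + 1))
  have eX := eq_pairedMultiset_of_list X a (fun r => (a, r)) (by simp) hXa.le
  have eY := eq_pairedMultiset_of_list Y b (fun r => (b, r)) (by simp) hYb.le
  have hi := h.toIndexed hX hY ((map_pairedSeq _ _ _).trans eX.symm)
    ((map_pairedSeq _ _ _).trans eY.symm)
  have cX := congrArg Multiset.card eX
  have cY := congrArg Multiset.card eY
  rw [card_pairedMultiset] at cX cY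
  rw [cX, cY]
  exact hi.card_le_add hA hB ha hb hAab hBab (fun i _ => adj _ _ i) (even _ _ 0)
    (pairedSeq_of_le _ _ (by rw [List.length_map, Multiset.length_toList]; omega)) (fun i _ => adj _ _ i) (even _ _ 0)
    (pairedSeq_of_le _ _ (by rw [List.length_map, Multiset.length_toList]; omega))

theorem coprime_and_card_le (h : IsMinZeroSumPair X Y) {A B k a b d : ℕ} (hA : 0 < A) (hB : 0 < B)
    (hX : ∀ x ∈ X, 0 < x ∧ x ≤ (A : ℤ)) (hY : ∀ y ∈ Y, 0 < y ∧ y ≤ (B : ℤ))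
    (hk : X.card + Y.card + k = A + B) (hkA : 5 * k ≤ A) (hkB : 5 * k ≤ B)
    (ha : 0 < a) (hbB : b * d ≤ B)
    (hr : (X.filter (· ≠ (a : ℤ))).card + (Y.filter (· ≠ ((b * d : ℕ) : ℤ))).card ≤ k)
    (hb : X.count (a : ℤ) < b) (hd : 0 < d) :
    d = 1 ∧ X.card + Y.card ≤ a + b := by
  have cX := card_filter_ne_add_count X a
  have cY := card_filter_ne_add_count Y ((b * d : ℕ) : ℤ)
  have pB := h.card_left_le hX hY (by omega) (by omega)
  have qA := h.swap.card_left_le hY hX (by omega) (by omega)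
  have hd1 : d = 1 := by
    by_contra hne
    have : b * 2 ≤ b * d := Nat.mul_le_mul_left b (by omega)
    omega
  refine ⟨hd1, ?_⟩
  subst hd1
  rw [mul_one] at *
  have top := h.card_le_of_top_interval hX hY (by omega) (by omega) (a := a) (b := b)
    (c := max a (A - b)) (by omega) (by omega) (by omega)
  have := h.card_le_add hX hY (by omega) (by omega) (a := a) (b := b) (by omega) (by omega)
    (by omega) (by omega) (by omega) (by omega)
  omega

theorem card_eq_of_le_count (h : IsMinZeroSumPair X Y) {a b d : ℕ} (hb : 0 < b)
    (hX : b ≤ X.count ((a * d : ℕ) : ℤ)) (hY : a ≤ Y.count ((b * d : ℕ) : ℤ)) :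
    X.card + Y.card = a + b := by
  rcases h.minimal _ (Multiset.le_count_iff_replicate_le.mp hX) _
    (Multiset.le_count_iff_replicate_le.mp hY) (by simp; ring) with h1 | h1
  · have := congrArg Multiset.card h1.1
    simp at this
    omega
  · rw [← h1.1, ← h1.2]
    simp [add_comm]

theorem exists_coprime_card_le (h : IsMinZeroSumPair X Y) {A B : ℕ} (hA : 0 < A) (hB : 0 < B)
    (hX : ∀ x ∈ X, 0 < x ∧ x ≤ (A : ℤ)) (hY : ∀ y ∈ Y, 0 < y ∧ y ≤ (B : ℤ)) :
    ∃ x y, 1 ≤ x ∧ x ≤ B ∧ 1 ≤ y ∧ y ≤ A ∧ x.Coprime y ∧ X.card + Y.card ≤ x + y := by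
  have pB := h.card_left_le hX hY (by omega) (by omega)
  have qA := h.swap.card_left_le hY hX (by omega) (by omega)
  obtain ⟨k, hk⟩ : ∃ k, X.card + Y.card + k = A + B := ⟨A + B - (X.card + Y.card), by omega⟩
  by_cases hsmall : A < 5 * k ∨ B < 5 * k
  · obtain ⟨x, y, h1, h2, h3, h4, h5, h6⟩ := exists_coprime_pair hA hB hsmall
    exact ⟨x, y, h1, h2, h3, h4, h5, by omega⟩
  push Not at hsmall
  obtain ⟨Q, n, a, hQX, hQ⟩ := exists_eq_pairedMultiset X
  obtain ⟨Q', n', b, hQY, hQ'⟩ := exists_eq_pairedMultiset Y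
  have h1 := h.card_add_length_le hX hY (by omega) (by omega) hQX hQY hQ hQ'
  have cX := congrArg Multiset.card hQX
  have cY := congrArg Multiset.card hQY
  rw [card_pairedMultiset] at cX cY
  have nX : n ≤ X.count a := by rw [hQX]; simp [pairedMultiset]
  have nY : n' ≤ Y.count b := by rw [hQY]; simp [pairedMultiset]
  have fX := card_filter_ne_add_count X a
  have fY := card_filter_ne_add_count Y b
  obtain ⟨a0, aA⟩ := hX a (Multiset.count_pos.mp (by omega))
  obtain ⟨b0, bB⟩ := hY b (Multiset.count_pos.mp (by omega))
  have h2 := h.card_add_card_filter_ne_le hX hY (by omega) (by omega) (a := a) (b := b)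
    (by omega) (by omega)
  lift a to ℕ using a0.le
  lift b to ℕ using b0.le
  have hd : 0 < Nat.gcd a b := Nat.gcd_pos_of_pos_left _ (by omega)
  obtain ⟨a', b', hcop, ea, eb⟩ := Nat.exists_coprime a b
  generalize Nat.gcd a b = d at hd ea eb
  have ha' : 0 < a' := Nat.pos_of_ne_zero (by rintro rfl; simp at ea; omega)
  have hb' : 0 < b' := Nat.pos_of_ne_zero (by rintro rfl; simp at eb; omega)
  have la : a' ≤ a := by rw [ea]; exact Nat.le_mul_of_pos_right _ hd
  have lb : b' ≤ b := by rw [eb]; exact Nat.le_mul_of_pos_right _ hd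
  rcases lt_or_ge (X.count (a : ℤ)) b' with hlt | hge
  · obtain ⟨rfl, hle⟩ := h.coprime_and_card_le (k := k) (a := a) (b := b') (d := d) hA hB hX hY
      hk hsmall.1 hsmall.2 (by omega) (by omega) (by rw [← eb]; omega) hlt hd
    exact ⟨b', a', hb', by omega, ha', by omega, hcop.symm, by omega⟩
  rcases lt_or_ge (Y.count (b : ℤ)) a' with hlt | hge'
  · obtain ⟨rfl, hle⟩ := h.swap.coprime_and_card_le (k := k) (a := b) (b := a') (d := d) hB hA hY
      hX (by omega) hsmall.2 hsmall.1 (by omega) (by omega) (by rw [← ea]; omega) hlt hd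
    exact ⟨b', a', hb', by omega, ha', by omega, hcop.symm, by omega⟩
  · have := h.card_eq_of_le_count (a := a') (b := b') (d := d) hb' (by rwa [← ea]) (by rwa [← eb])
    exact ⟨b', a', hb', by omega, ha', by omega, hcop.symm, by omega⟩

end IsMinZeroSumPair

end

theorem Multiset.eq_and_eq_of_add_eq {α : Type*} {T U X Y : Multiset α} (hT : T ≤ X) (hU : U ≤ Y)
    (h : T + U = X + Y) : T = X ∧ U = Y := by
  have h1 := Multiset.card_le_card hT
  have h2 := Multiset.card_le_card hU
  have h3 := congrArg Multiset.card h
  simp only [Multiset.card_add] at h3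
  exact ⟨Multiset.eq_of_le_of_card_le hT (by omega), Multiset.eq_of_le_of_card_le hU (by omega)⟩

theorem Multiset.filter_pos_add_map_neg (S : Multiset ℤ) :
    S.filter (0 < ·) + ((S.filter (¬ 0 < ·)).map Neg.neg).map Neg.neg = S := by
  rw [Multiset.map_map, neg_comp_neg, Multiset.map_id, Multiset.filter_add_not]

theorem IsMinZeroSum.isMinZeroSumPair {S X Y : Multiset ℤ} (hS : IsMinZeroSum S)
    (h : X + Y.map Neg.neg = S) : IsMinZeroSumPair X Y where
  sum_eq := by
    have := hS.1
    rw [← h, Multiset.sum_add, Multiset.sum_map_neg'] at this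
    linarith
  minimal T hT U hU hs := by
    have hU' := Multiset.map_le_map hU (f := Neg.neg)
    have hle : T + U.map Neg.neg ≤ S := h ▸ add_le_add hT hU'
    have hsum : (T + U.map Neg.neg).sum = 0 := by
      rw [Multiset.sum_add, Multiset.sum_map_neg', hs]
      ring
    by_cases h0 : T + U.map Neg.neg = 0
    · left
      simpa using h0
    by_cases h1 : T + U.map Neg.neg = S
    · obtain ⟨h2, h3⟩ := Multiset.eq_and_eq_of_add_eq hT hU' (h1.trans h.symm)
      exact .inr ⟨h2, Multiset.map_injective neg_injective h3⟩
    · exact (hS.2 _ hle h0 h1 hsum).elim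

theorem IsMinZeroSum.exists_coprime_card_le {S : Multiset ℤ} (hS : IsMinZeroSum S) {m M : ℕ}
    (hm : 0 < m) (hM : 0 < M) (h : ∀ x ∈ S, -(m : ℤ) ≤ x ∧ x ≤ (M : ℤ)) :
    ∃ x y, 1 ≤ x ∧ x ≤ m ∧ 1 ≤ y ∧ y ≤ M ∧ x.Coprime y ∧ S.card ≤ x + y := by
  by_cases h0 : (0 : ℤ) ∈ S
  · have : ({0} : Multiset ℤ) = S := by
      by_contra hne
      exact hS.2 {0} (Multiset.singleton_le.mpr h0) (by simp) hne (by simp)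
    rw [← this]
    exact ⟨1, 1, le_rfl, hm, le_rfl, hM, by simp, by simp⟩
  have hdec := Multiset.filter_pos_add_map_neg S
  have hcard := congrArg Multiset.card hdec
  rw [Multiset.card_add, Multiset.card_map] at hcard
  rw [← hcard]
  refine (hS.isMinZeroSumPair hdec).exists_coprime_card_le hM hm (fun x hx => ?_) (fun y hy => ?_)
  · rw [Multiset.mem_filter] at hx
    exact ⟨hx.2, (h x hx.1).2⟩
  · obtain ⟨x, hx, rfl⟩ := Multiset.mem_map.mp hy
    rw [Multiset.mem_filter] at hx
    have hx0 : x ≠ 0 := fun e => h0 (e ▸ hx.1)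
    have := (h x hx.1).1
    omega

theorem isMinZeroSum_replicate_add_replicate {x y d : ℕ} (hxy : x.Coprime y) (hx : 0 < x)
    (hy : 0 < y) (hd : 0 < d) :
    IsMinZeroSum (Multiset.replicate x ((y * d : ℕ) : ℤ) +
      Multiset.replicate y (-((x * d : ℕ) : ℤ))) := by
  refine ⟨by simp; ring, fun T hT h0 hne hsum => ?_⟩
  have hyd : 0 < y * d := Nat.mul_pos hy hd
  have hxd : 0 < x * d := Nat.mul_pos hx hd
  have hdec := Multiset.filter_add_not (fun z : ℤ => 0 < z) T
  have pos : ∀ z ∈ Multiset.replicate x ((y * d : ℕ) : ℤ), 0 < z := fun z hz => by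
    rw [Multiset.eq_of_mem_replicate hz]
    omega
  have neg : ∀ z ∈ Multiset.replicate y (-((x * d : ℕ) : ℤ)), ¬ 0 < z := fun z hz => by
    rw [Multiset.eq_of_mem_replicate hz]
    omega
  have h1 := Multiset.filter_le_filter (fun z : ℤ => 0 < z) hT
  have h2 := Multiset.filter_le_filter (fun z : ℤ => ¬ 0 < z) hT
  rw [Multiset.filter_add, Multiset.filter_eq_self.mpr pos, Multiset.filter_eq_nil.mpr neg,
    add_zero] at h1
  rw [Multiset.filter_add, Multiset.filter_eq_self.mpr neg,
    Multiset.filter_eq_nil.mpr fun z hz => not_not.mpr (pos z hz), zero_add] at h2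
  obtain ⟨i, hi, ei⟩ := Multiset.le_replicate_iff.mp h1
  obtain ⟨j, hj, ej⟩ := Multiset.le_replicate_iff.mp h2
  rw [ei, ej] at hdec
  rw [← hdec] at hsum h0 hne
  have hij : i * y = j * x := by
    have : ((i * y * d : ℕ) : ℤ) = ((j * x * d : ℕ) : ℤ) := by
      simp at hsum
      push_cast
      linarith
    exact Nat.eq_of_mul_eq_mul_right hd (by exact_mod_cast this)
  obtain ⟨c, rfl⟩ : x ∣ i := hxy.dvd_of_dvd_mul_right ⟨j, by rw [hij, mul_comm]⟩
  have hj : j = y * c := Nat.eq_of_mul_eq_mul_left hx (by linarith)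
  subst hj
  have hc : c ≤ 1 := by
    by_contra hc
    have : x * 2 ≤ x * c := Nat.mul_le_mul_left x (by omega)
    omega
  interval_cases c <;> simp at h0 hne

theorem exists_isMinZeroSum_card {x y : ℤ} (h : x * y < 0) :
    ∃ S : Multiset ℤ, IsMinZeroSum S ∧ (∀ z ∈ S, z = x ∨ z = y) ∧
      (S.card : ℤ) = (|x| + |y|) / (Int.gcd x y : ℤ) := by
  wlog hx : x < 0 generalizing x y
  · have hy : y < 0 := by
      by_contra hy
      exact absurd (mul_nonneg (not_lt.mp hx) (not_lt.mp hy)) (not_le.mpr h)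
    obtain ⟨S, h1, h2, h3⟩ := this (by rwa [mul_comm]) hy
    exact ⟨S, h1, fun z hz => (h2 z hz).symm, by rw [h3, add_comm, Int.gcd_comm]⟩
  have hy : 0 < y := pos_of_mul_neg_left (mul_comm x y ▸ h) hx.le
  obtain ⟨a, rfl⟩ : ∃ a : ℕ, x = -a := ⟨x.natAbs, by omega⟩
  obtain ⟨b, rfl⟩ : ∃ b : ℕ, y = b := ⟨y.natAbs, by omega⟩
  have hd : 0 < Nat.gcd a b := Nat.gcd_pos_of_pos_left _ (by omega)
  obtain ⟨a', b', hcop, ea, eb⟩ := Nat.exists_coprime a b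
  rw [Int.neg_gcd, Int.gcd_natCast_natCast]
  generalize Nat.gcd a b = d at hd ea eb
  subst ea eb
  refine ⟨_, isMinZeroSum_replicate_add_replicate hcop (Nat.pos_of_ne_zero ?_)
    (Nat.pos_of_ne_zero ?_) hd, fun z hz => ?_, ?_⟩
  · rintro rfl
    simp at hx
  · rintro rfl
    simp at hy
  · rcases Multiset.mem_add.mp hz with hz | hz
    · exact .inr (Multiset.eq_of_mem_replicate hz)
    · exact .inl (Multiset.eq_of_mem_replicate hz)
  · rw [abs_neg, Nat.abs_cast, Nat.abs_cast]
    simp only [Multiset.card_add, Multiset.card_replicate]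
    rw [← Nat.cast_add, ← add_mul]
    exact_mod_cast (Nat.mul_div_cancel _ hd).symm

theorem stmt_1 (m M : ℕ) (hm : 0 < m) (hM : 0 < M) :
    (davenport m M : ℤ) = chi m M := by
  have bound : ∀ n ∈ {n : ℕ | ∃ S : Multiset ℤ, IsMinZeroSum S ∧
      (∀ x ∈ S, -(m : ℤ) ≤ x ∧ x ≤ (M : ℤ)) ∧ S.card = n}, n ≤ m + M := by
    rintro n ⟨S, hS, hr, rfl⟩
    obtain ⟨x, y, -, hx, -, hy, -, hle⟩ := hS.exists_coprime_card_le hm hM hr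
    omega
  have lower : ∀ z ∈ {z : ℤ | ∃ x y : ℤ, (-(m : ℤ) ≤ x ∧ x ≤ (M : ℤ)) ∧
      (-(m : ℤ) ≤ y ∧ y ≤ (M : ℤ)) ∧ x * y < 0 ∧ z = (|x| + |y|) / (Int.gcd x y : ℤ)},
      z ≤ davenport m M := by
    rintro z ⟨x, y, hx, hy, hxy, rfl⟩
    obtain ⟨S, hS, hr, hc⟩ := exists_isMinZeroSum_card hxy
    rw [← hc]
    refine Nat.cast_le.mpr (le_csSup ⟨_, bound⟩ ⟨S, hS, fun z hz => ?_, rfl⟩)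
    rcases hr z hz with rfl | rfl <;> assumption
  have mem : ∀ x y : ℕ, 1 ≤ x → x ≤ m → 1 ≤ y → y ≤ M → x.Coprime y →
      ((x + y : ℕ) : ℤ) ∈ {z : ℤ | ∃ x y : ℤ, (-(m : ℤ) ≤ x ∧ x ≤ (M : ℤ)) ∧
      (-(m : ℤ) ≤ y ∧ y ≤ (M : ℤ)) ∧ x * y < 0 ∧ z = (|x| + |y|) / (Int.gcd x y : ℤ)} := by
    intro x y hx hxm hy hyM hc
    refine ⟨-x, y, by omega, by omega, ?_, ?_⟩
    · rw [neg_mul, neg_lt_zero]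
      exact_mod_cast Nat.mul_pos hx hy
    · rw [Int.neg_gcd, Int.gcd_natCast_natCast, hc]
      simp
  have one_mem : (1 : ℕ) ∈ {n : ℕ | ∃ S : Multiset ℤ, IsMinZeroSum S ∧
      (∀ x ∈ S, -(m : ℤ) ≤ x ∧ x ≤ (M : ℤ)) ∧ S.card = n} := by
    refine ⟨{0}, ⟨by simp, fun T hT h0 hne => ?_⟩, by simp, by simp⟩
    rcases Multiset.le_singleton.mp hT with h | h <;> contradiction
  refine le_antisymm ?_ (csSup_le ⟨_, mem 1 1 le_rfl hm le_rfl hM (by simp)⟩ lower)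
  obtain ⟨S, hS, hr, hc⟩ := Nat.sSup_mem ⟨_, one_mem⟩ ⟨_, bound⟩
  obtain ⟨x, y, hx, hxm, hy, hyM, hcop, hle⟩ := hS.exists_coprime_card_le hm hM hr
  rw [hc] at hle
  exact (Nat.cast_le.mpr hle).trans (le_csSup ⟨_, lower⟩ (mem x y hx hxm hy hyM hcop))
end

section
/- Let m and M be positive integers with ρ(m,M) = 1. Then D(⟦-m,M⟧) = m + M - 1. -/
noncomputable def rho (m M : ℕ) : ℕ :=
  sInf {t : ℕ | ∃ t' : ℕ, t' ≤ t ∧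
    Int.gcd ((M : ℤ) - (t' : ℤ)) ((m : ℤ) - ((t - t' : ℕ) : ℤ)) = 1}

theorem IsMinZeroSum.map_neg {S : Multiset ℤ} (hS : IsMinZeroSum S) :
    IsMinZeroSum (S.map (fun x => -x)) := by
  refine ⟨by rw [Multiset.sum_map_neg, Multiset.map_id', hS.1, neg_zero], fun T hT h0 hne hsum => ?_⟩
  have hTT : (T.map (fun x => -x)).map (fun x => -x) = T := by simp
  have hSS : (S.map (fun x => -x)).map (fun x => -x) = S := by simp
  refine hS.2 (T.map (fun x => -x)) ?_ ?_ ?_ ?_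
  · exact hSS ▸ Multiset.map_le_map hT
  · simpa using h0
  · intro h
    exact hne (by rw [← h, hTT])
  · rw [Multiset.sum_map_neg, Multiset.map_id', hsum, neg_zero]

theorem Multiset.exists_pos_of_sum_pos {R : Multiset ℤ} (h : 0 < R.sum) : ∃ y ∈ R, 0 < y := by
  by_contra! hR
  have := Multiset.sum_le_card_nsmul R 0 hR
  simp at this
  omega

theorem Multiset.exists_neg_of_sum_neg {R : Multiset ℤ} (h : R.sum < 0) : ∃ y ∈ R, y < 0 := by
  by_contra! hR
  have := Multiset.sum_nonneg hR
  omega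

/-- The elements of a minimal zero-sum sequence can be ordered, starting from any positive element
below `M`, so that the nonempty partial sums are distinct and lie in `⟦1 - m, M - 1⟧`. -/
theorem IsMinZeroSum.exists_partial_sums {S : Multiset ℤ} {m M : ℕ} (hS : IsMinZeroSum S)
    (hm : 0 < m) (hb : ∀ x ∈ S, -(m : ℤ) ≤ x ∧ x ≤ (M : ℤ)) {x : ℤ} (hx : x ∈ S) (hx0 : 0 < x)
    (hxM : x < M) (k : ℕ) (hk : k + 1 ≤ S.card) :
    ∃ T ≤ S, T.card = k + 1 ∧ ∃ P : Finset ℤ, P.card = k + 1 ∧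
      P ⊆ Finset.Icc (1 - (m : ℤ)) (M - 1) ∧ T.sum ∈ P ∧
      ∀ p ∈ P, ∃ U ≤ T, U ≠ 0 ∧ U.sum = p := by
  induction k with
  | zero =>
    refine ⟨{x}, by simpa using hx, by simp, {x}, by simp, ?_, by simp, ?_⟩
    · simp only [Finset.singleton_subset_iff, Finset.mem_Icc]
      omega
    · intro p hp
      exact ⟨{x}, le_rfl, by simp, by simpa using (Finset.mem_singleton.1 hp).symm⟩
  | succ k ih =>
    obtain ⟨T, hT, hTc, P, hPc, hPs, hTP, hP⟩ := ih (by omega)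
    have hT0 : T ≠ 0 := by rintro rfl; simp at hTc
    have hTS : T ≠ S := by rintro rfl; omega
    have hs := hS.2 T hT hT0 hTS
    have hadd : T + (S - T) = S := add_tsub_cancel_of_le hT
    have hsum : T.sum + (S - T).sum = 0 := by rw [← Multiset.sum_add, hadd, hS.1]
    have hrange := Finset.mem_Icc.1 (hPs hTP)
    obtain ⟨y, hyR, hy⟩ : ∃ y ∈ S - T, y + T.sum ∈ Finset.Icc (1 - (m : ℤ)) (M - 1) := by
      rcases lt_or_gt_of_ne hs with h | h
      · obtain ⟨y, hy, hy0⟩ := Multiset.exists_pos_of_sum_pos (R := S - T) (by omega)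
        have := hb y (Multiset.mem_of_le tsub_le_self hy)
        exact ⟨y, hy, Finset.mem_Icc.2 (by omega)⟩
      · obtain ⟨y, hy, hy0⟩ := Multiset.exists_neg_of_sum_neg (R := S - T) (by omega)
        have := hb y (Multiset.mem_of_le tsub_le_self hy)
        exact ⟨y, hy, Finset.mem_Icc.2 (by omega)⟩
    have hle : y ::ₘ T ≤ S := by
      rw [← Multiset.singleton_add, add_comm]
      calc T + {y} ≤ T + (S - T) := by gcongr; simpa using hyR
        _ = S := hadd
    have hnew : y + T.sum ∉ P := by
      intro hmem
      obtain ⟨U, hU, hU0, hUs⟩ := hP _ hmem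
      have hUle : U ≤ y ::ₘ T := hU.trans (Multiset.le_cons_self T y)
      have hadd' : U + (y ::ₘ T - U) = y ::ₘ T := add_tsub_cancel_of_le hUle
      have hcard := congrArg Multiset.card hadd'
      have hsum' := congrArg Multiset.sum hadd'
      simp only [Multiset.card_add, Multiset.card_cons, Multiset.sum_add, Multiset.sum_cons]
        at hcard hsum'
      have hUc := Multiset.card_le_card hU
      have hUp := Multiset.card_pos.2 hU0
      have hleS := Multiset.card_le_card hle
      rw [Multiset.card_cons] at hleS
      refine hS.2 (y ::ₘ T - U) (tsub_le_self.trans hle) ?_ ?_ (by omega)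
      · intro h
        rw [h, Multiset.card_zero] at hcard
        omega
      · intro h
        rw [h] at hcard
        omega
    refine ⟨y ::ₘ T, hle, by simp [hTc], insert (y + T.sum) P, ?_, ?_, by simp, ?_⟩
    · rw [Finset.card_insert_of_notMem hnew, hPc]
    · exact Finset.insert_subset hy hPs
    · intro p hp
      rcases Finset.mem_insert.1 hp with rfl | hp
      · exact ⟨y ::ₘ T, le_rfl, by simp, by simp⟩
      · obtain ⟨U, hU, hU'⟩ := hP p hp
        exact ⟨U, hU.trans (Multiset.le_cons_self T y), hU'⟩

theorem IsMinZeroSum.card_lt_of_pos_lt {S : Multiset ℤ} {m M : ℕ} (hS : IsMinZeroSum S)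
    (hm : 0 < m) (hb : ∀ x ∈ S, -(m : ℤ) ≤ x ∧ x ≤ (M : ℤ)) {x : ℤ} (hx : x ∈ S) (hx0 : 0 < x)
    (hxM : x < M) : S.card < m + M := by
  have hpos := Multiset.card_pos_iff_exists_mem.2 ⟨x, hx⟩
  obtain ⟨-, -, -, P, hPc, hPs, -⟩ :=
    hS.exists_partial_sums hm hb hx hx0 hxM (S.card - 1) (by omega)
  have := Finset.card_le_card hPs
  rw [Int.card_Icc] at this
  omega

theorem IsMinZeroSum.card_lt_of_neg_lt {S : Multiset ℤ} {m M : ℕ} (hS : IsMinZeroSum S)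
    (hM : 0 < M) (hb : ∀ x ∈ S, -(m : ℤ) ≤ x ∧ x ≤ (M : ℤ)) {x : ℤ} (hx : x ∈ S) (hx0 : x < 0)
    (hxm : -(m : ℤ) < x) : S.card < m + M := by
  have := hS.map_neg.card_lt_of_pos_lt (m := M) (M := m) hM (x := -x) (by
    intro z hz
    obtain ⟨w, hw, rfl⟩ := Multiset.mem_map.1 hz
    have := hb w hw
    omega) (Multiset.mem_map_of_mem _ hx) (by omega) (by omega)
  rw [Multiset.card_map] at this
  omega

theorem Multiset.eq_replicate_add_replicate {S : Multiset ℤ} {u v : ℤ}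
    (h : ∀ x ∈ S, x = u ∨ x = v) :
    ∃ i j : ℕ, S = Multiset.replicate i u + Multiset.replicate j v := by
  induction S using Multiset.induction_on with
  | empty => exact ⟨0, 0, by simp⟩
  | cons x S ih =>
    obtain ⟨i, j, rfl⟩ := ih fun y hy => h y (Multiset.mem_cons_of_mem hy)
    rcases h x (Multiset.mem_cons_self x _) with rfl | rfl
    · exact ⟨i + 1, j, by rw [Multiset.replicate_succ, Multiset.cons_add]⟩
    · exact ⟨i, j + 1, by rw [Multiset.replicate_succ, Multiset.add_cons]⟩

theorem Multiset.exists_of_le_replicate_add_replicate {T : Multiset ℤ} {a b : ℕ} {u v : ℤ}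
    (h : T ≤ Multiset.replicate a u + Multiset.replicate b v) :
    ∃ i ≤ a, ∃ j ≤ b, T = Multiset.replicate i u + Multiset.replicate j v := by
  obtain ⟨i, hi, hi'⟩ := Multiset.le_replicate_iff.1
    (Multiset.inter_le_right (s := T) (t := Multiset.replicate a u))
  obtain ⟨j, hj, hj'⟩ := Multiset.le_replicate_iff.1 (tsub_le_iff_left.2 h)
  exact ⟨i, hi, j, hj, by rw [← hi', ← hj', add_comm, Multiset.sub_add_inter]⟩

theorem isMinZeroSum_replicate {a b : ℕ} (ha : 0 < a) (hab : Nat.Coprime a b) :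
    IsMinZeroSum (Multiset.replicate a (b : ℤ) + Multiset.replicate b (-(a : ℤ))) := by
  refine ⟨by simp [mul_comm], fun T hT h0 hne hsum => ?_⟩
  obtain ⟨i, hi, j, hj, rfl⟩ := Multiset.exists_of_le_replicate_add_replicate hT
  have hij : i * b = j * a := by
    simp only [Multiset.sum_add, Multiset.sum_replicate, nsmul_eq_mul] at hsum
    zify
    linarith
  obtain ⟨c, rfl⟩ : a ∣ i := hab.dvd_of_dvd_mul_right ⟨j, by rw [hij, mul_comm]⟩
  have hj' : j = c * b := Nat.eq_of_mul_eq_mul_right ha (by rw [← hij]; ring)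
  have hc : c ≤ 1 := by
    by_contra! hc
    nlinarith
  interval_cases c
  · exact h0 (by simp [hj'])
  · exact hne (by simp [hj'])

theorem IsMinZeroSum.card_lt {S : Multiset ℤ} {m M : ℕ} (hS : IsMinZeroSum S)
    (hm : 0 < m) (hM : 0 < M) (hg : ¬ Nat.Coprime m M)
    (hb : ∀ x ∈ S, -(m : ℤ) ≤ x ∧ x ≤ (M : ℤ)) : S.card < m + M := by
  by_contra! hcard
  have hext : ∀ x ∈ S, x = M ∨ x = -(m : ℤ) := by
    intro x hx
    by_contra! hne
    have hbx := hb x hx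
    rcases lt_trichotomy x 0 with h | rfl | h
    · exact hcard.not_gt (hS.card_lt_of_neg_lt hM hb hx h (by omega))
    · refine hS.2 {0} (by simpa using hx) (by simp) ?_ (by simp)
      rintro rfl
      simp at hcard
      omega
    · exact hcard.not_gt (hS.card_lt_of_pos_lt hm hb hx h (by omega))
  obtain ⟨i, j, rfl⟩ := Multiset.eq_replicate_add_replicate hext
  obtain ⟨g, a, b, hg0, hab, rfl, rfl⟩ := Nat.exists_coprime' (Nat.gcd_pos_of_pos_left M hm)
  have ha : 0 < a := Nat.pos_of_mul_pos_right hm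
  have hb0 : 0 < b := Nat.pos_of_mul_pos_right hM
  have hg1 : 1 < g := by
    by_contra! h
    obtain rfl : g = 1 := by omega
    simp [hab] at hg
  simp only [Multiset.card_add, Multiset.card_replicate] at hcard
  have hsum := hS.1
  simp only [Multiset.sum_add, Multiset.sum_replicate, nsmul_eq_mul] at hsum
  have hij : i * b = j * a := by
    refine Nat.eq_of_mul_eq_mul_right hg0 ?_
    zify
    push_cast at hsum
    linarith
  obtain ⟨c, rfl⟩ : a ∣ i := hab.dvd_of_dvd_mul_right ⟨j, by rw [hij, mul_comm]⟩
  obtain rfl : j = c * b := Nat.eq_of_mul_eq_mul_right ha (by rw [← hij]; ring)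
  have hc : 1 < c := by
    by_contra! hc
    nlinarith
  refine hS.2 (Multiset.replicate a ((b * g : ℕ) : ℤ) + Multiset.replicate b (-((a * g : ℕ) : ℤ)))
    ?_ ?_ ?_ ?_
  · refine add_le_add ?_ ?_ <;> refine (Multiset.replicate_le_replicate _).2 ?_ <;> nlinarith
  · intro h
    have := congrArg Multiset.card h
    simp at this
    omega
  · intro h
    have := congrArg Multiset.card h
    simp only [Multiset.card_add, Multiset.card_replicate] at this
    nlinarith
  · simp only [Multiset.sum_add, Multiset.sum_replicate, nsmul_eq_mul]
    push_cast
    ring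

theorem coprime_of_rho_eq_one {m M : ℕ} (hm : 0 < m) (hM : 0 < M) (h : rho m M = 1) :
    ¬ Nat.Coprime m M ∧ (Nat.Coprime m (M - 1) ∨ Nat.Coprime (m - 1) M) := by
  unfold rho at h
  constructor
  · intro hc
    have : sInf {t : ℕ | ∃ t' : ℕ, t' ≤ t ∧
        Int.gcd ((M : ℤ) - (t' : ℤ)) ((m : ℤ) - ((t - t' : ℕ) : ℤ)) = 1} ≤ 0 :=
      Nat.sInf_le ⟨0, le_rfl, by simpa [Nat.coprime_iff_gcd_eq_one] using hc.symm⟩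
    omega
  · have hmem := Nat.sInf_mem (Nat.nonempty_of_pos_sInf (h.symm ▸ one_pos))
    rw [h] at hmem
    obtain ⟨t', ht', hgcd⟩ := hmem
    interval_cases t'
    · right
      have e : (m : ℤ) - ((1 - 0 : ℕ) : ℤ) = ((m - 1 : ℕ) : ℤ) := by omega
      rw [e, Nat.cast_zero, sub_zero, Int.gcd_natCast_natCast] at hgcd
      exact Nat.Coprime.symm hgcd
    · left
      have e : (M : ℤ) - ((1 : ℕ) : ℤ) = ((M - 1 : ℕ) : ℤ) := by omega
      rw [e, Nat.sub_self, Nat.cast_zero, sub_zero, Int.gcd_natCast_natCast] at hgcd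
      exact Nat.Coprime.symm hgcd

theorem stmt_8 (m M : ℕ) (hm : 0 < m) (hM : 0 < M) (h : rho m M = 1) :
    (davenport m M : ℤ) = (m : ℤ) + (M : ℤ) - 1 := by
  obtain ⟨hg, hc⟩ := coprime_of_rho_eq_one hm hM h
  have hm1 : m ≠ 1 := by rintro rfl; simp at hg
  have hD : davenport m M = m + M - 1 := by
    refine IsGreatest.csSup_eq ⟨?_, ?_⟩
    · obtain ⟨a, b, ha, ham, hbM, hab, hsum⟩ : ∃ a b : ℕ, 0 < a ∧ a ≤ m ∧ b ≤ M ∧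
          Nat.Coprime a b ∧ a + b = m + M - 1 := by
        rcases hc with hc | hc
        · exact ⟨m, M - 1, by omega, by omega, by omega, hc, by omega⟩
        · exact ⟨m - 1, M, by omega, by omega, by omega, hc, by omega⟩
      refine ⟨_, isMinZeroSum_replicate ha hab, fun x hx => ?_, by simpa using hsum⟩
      rcases Multiset.mem_add.1 hx with hx | hx <;> rw [Multiset.eq_of_mem_replicate hx] <;> omega
    · rintro n ⟨S, hS, hb, rfl⟩
      have := hS.card_lt hm hM hg hb
      omega
  omega
end
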